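/- (CBN surface preservation.) Let t, u be CBN terms and s' a λ!-term. (1) Stability: if tⁿ →S* s' then there is a CBN term s with sⁿ = s'. (2) Normal forms: t is a →ⁿS-normal form if and only if tⁿ is a →S-normal form. (3) Simulations: t →ⁿS* u if and only if tⁿ →S* uⁿ; moreover, the corresponding reduction sequences contain the same number of dB-steps (resp. the number of s-steps on the CBN side equals the number of s!-steps on the λ! side). -/

import Mathlib

namespace BangPaper

/-! ### Generic rewriting notions -/

/-- `a` is a normal form for the relation `r`. -/
def IsNF {α : Type*} (r : α → α → Prop) (a : α) : Prop := ∀ b, ¬ r a b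

/-- Reflexive-transitive closure of the union of two relations,
counting the number of steps of each. -/
inductive Counted2 {α : Type*} (r₁ r₂ : α → α → Prop) : ℕ → ℕ → α → α → Prop
  | refl (t : α) : Counted2 r₁ r₂ 0 0 t t
  | step₁ {t u v : α} {m n : ℕ} :
      r₁ t u → Counted2 r₁ r₂ m n u v → Counted2 r₁ r₂ (m + 1) n t v
  | step₂ {t u v : α} {m n : ℕ} :
      r₂ t u → Counted2 r₁ r₂ m n u v → Counted2 r₁ r₂ m (n + 1) t v

/-- Reflexive-transitive closure of the union of three relations,
counting the number of steps of each. -/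
inductive Counted3 {α : Type*} (r₁ r₂ r₃ : α → α → Prop) : ℕ → ℕ → ℕ → α → α → Prop
  | refl (t : α) : Counted3 r₁ r₂ r₃ 0 0 0 t t
  | step₁ {t u v : α} {m n k : ℕ} :
      r₁ t u → Counted3 r₁ r₂ r₃ m n k u v → Counted3 r₁ r₂ r₃ (m + 1) n k t v
  | step₂ {t u v : α} {m n k : ℕ} :
      r₂ t u → Counted3 r₁ r₂ r₃ m n k u v → Counted3 r₁ r₂ r₃ m (n + 1) k t v
  | step₃ {t u v : α} {m n k : ℕ} :
      r₃ t u → Counted3 r₁ r₂ r₃ m n k u v → Counted3 r₁ r₂ r₃ m n (k + 1) t v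

/-! ### Terms of the distant Bang calculus λ! (de Bruijn representation) -/

/-- Terms of λ!: variables, application, abstraction, bang, dereliction and
explicit substitution (`sub t u` is `t[x←u]`, the binder being in `t`). -/
inductive T : Type
  | var : ℕ → T
  | app : T → T → T
  | lam : T → T
  | bang : T → T
  | der : T → T
  | sub : T → T → T

namespace T

/-- Lift (shift by one) the free de Bruijn variables `≥ k`. -/
def lift (k : ℕ) : T → T
  | var n => if n < k then var n else var (n + 1)
  | app a b => app (lift k a) (lift k b)
  | lam a => lam (lift (k + 1) a)
  | bang a => bang (lift k a)
  | der a => der (lift k a)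
  | sub a b => sub (lift (k + 1) a) (lift k b)

/-- Lift all free variables by `m` (crossing `m` binders). -/
def liftN (m : ℕ) (t : T) : T := (lift 0)^[m] t

/-- Lift all free variables except the first one by `m`
(used to push a term with one distinguished bound variable under `m` extra binders). -/
def liftUnder (m : ℕ) (t : T) : T := (lift 1)^[m] t

/-- Capture-avoiding substitution `t{k := u}` of `u` for de Bruijn variable `k`. -/
def subst : T → ℕ → T → T
  | var n, k, u => if n < k then var n else if n = k then liftN k u else var (n - 1)
  | app a b, k, u => app (subst a k u) (subst b k u)
  | lam a, k, u => lam (subst a (k + 1) u)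
  | bang a, k, u => bang (subst a k u)
  | der a, k, u => der (subst a k u)
  | sub a b, k, u => sub (subst a (k + 1) u) (subst b k u)

/-- The number of constructors (full size) of a term: it counts all
applications, abstractions, explicit substitutions, `!` and `der` occurrences. -/
def size : T → ℕ
  | var _ => 0
  | app a b => 1 + size a + size b
  | lam a => 1 + size a
  | bang a => 1 + size a
  | der a => 1 + size a
  | sub a b => 1 + size a + size b

end T

/-- Plugging a term into a list context `⟨·⟩[x₁←t₁]…[xₙ←tₙ]`
(represented as the list `[t₁, …, tₙ]`). -/
def fillL : T → List T → T
  | s, [] => s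
  | s, t :: L => fillL (T.sub s t) L

/-! ### Rewrite rules of λ! -/

/-- The names of the three rewrite rules of λ!: `dB`, `s!` and `d!`. -/
inductive Rule : Type
  | dB : Rule
  | sBang : Rule
  | dBang : Rule

/-- Root steps of the three rewrite rules of λ! (at a distance, capture-free):
`(dB)  L⟨λx.t⟩ u ↦ L⟨t[x←u]⟩`, `(s!)  t[x←L⟨!u⟩] ↦ L⟨t{x:=u}⟩`,
`(d!)  der(L⟨!t⟩) ↦ L⟨t⟩`. -/
inductive Root : Rule → T → T → Prop
  | dB (t u : T) (L : List T) :
      Root Rule.dB (T.app (fillL (T.lam t) L) u)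
        (fillL (T.sub t (T.liftN L.length u)) L)
  | sBang (t u : T) (L : List T) :
      Root Rule.sBang (T.sub t (fillL (T.bang u) L))
        (fillL (T.subst (T.liftUnder L.length t) 0 u) L)
  | dBang (t : T) (L : List T) :
      Root Rule.dBang (T.der (fillL (T.bang t) L)) (fillL t L)

/-! ### Contexts of λ! -/

/-- (Full) contexts of λ!: terms with exactly one hole, the hole may occur anywhere. -/
inductive Ctx : Type
  | hole : Ctx
  | appL : Ctx → T → Ctx
  | appR : T → Ctx → Ctx
  | lam : Ctx → Ctx
  | bang : Ctx → Ctx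
  | der : Ctx → Ctx
  | subL : Ctx → T → Ctx
  | subR : T → Ctx → Ctx

namespace Ctx

/-- Plugging a term in a context (possibly capturing its free variables). -/
def fill : Ctx → T → T
  | hole, s => s
  | appL C t, s => T.app (fill C s) t
  | appR t C, s => T.app t (fill C s)
  | lam C, s => T.lam (fill C s)
  | bang C, s => T.bang (fill C s)
  | der C, s => T.der (fill C s)
  | subL C t, s => T.sub (fill C s) t
  | subR t C, s => T.sub t (fill C s)

/-- Surface contexts: the hole does not occur under a `!`. -/
def Surface : Ctx → Prop
  | hole => True
  | appL C _ => Surface C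
  | appR _ C => Surface C
  | lam C => Surface C
  | bang _ => False
  | der C => Surface C
  | subL C _ => Surface C
  | subR _ C => Surface C

/-- Internal contexts: the full contexts that are not surface (the hole occurs under a `!`). -/
def Internal (C : Ctx) : Prop := ¬ Surface C

end Ctx

/-! ### Reductions of λ! -/

/-- `StepAt R C t u`: `t` rewrites to `u` by firing a redex of rule `R` under context `C`. -/
def StepAt (R : Rule) (C : Ctx) (t u : T) : Prop :=
  ∃ a b, Root R a b ∧ t = C.fill a ∧ u = C.fill b

/-- One step of rule `R` under some full context (`→F,R`). -/
def FStepR (R : Rule) (t u : T) : Prop := ∃ C : Ctx, StepAt R C t u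

/-- One step of rule `R` under some surface context (`→S,R`). -/
def SStepR (R : Rule) (t u : T) : Prop := ∃ C : Ctx, C.Surface ∧ StepAt R C t u

/-- One step of rule `R` under some internal context (`→I,R`). -/
def IStepR (R : Rule) (t u : T) : Prop := ∃ C : Ctx, C.Internal ∧ StepAt R C t u

/-- Full reduction `→F` of λ!. -/
def FStep (t u : T) : Prop := ∃ R, FStepR R t u

/-- Surface reduction `→S` of λ!. -/
def SStep (t u : T) : Prop := ∃ R, SStepR R t u

/-- Internal reduction `→I` of λ!. -/
def IStep (t u : T) : Prop := ∃ R, IStepR R t u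

/-- Diligent administrative surface reduction `→Sai`: `d!`-surface steps, together with
`dB`- and `s!`-surface steps whose source is a `→S,d!`-normal form. -/
def SaiStep (t u : T) : Prop :=
  SStepR Rule.dBang t u ∨
    ((SStepR Rule.dB t u ∨ SStepR Rule.sBang t u) ∧ IsNF (SStepR Rule.dBang) t)

/-- Diligent administrative full reduction `→Fai`: `d!`-full steps, together with
`dB`- and `s!`-full steps whose source is a `→F,d!`-normal form. -/
def FaiStep (t u : T) : Prop :=
  FStepR Rule.dBang t u ∨
    ((FStepR Rule.dB t u ∨ FStepR Rule.sBang t u) ∧ IsNF (FStepR Rule.dBang) t)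

/-! ### Terms of the CBN / CBV calculi (shared syntax, de Bruijn) -/

/-- Terms of the CBN/CBV calculi: variables, application, abstraction and
explicit substitution (no `!`, no `der`). -/
inductive LT : Type
  | var : ℕ → LT
  | app : LT → LT → LT
  | lam : LT → LT
  | sub : LT → LT → LT

namespace LT

/-- Lift (shift by one) the free de Bruijn variables `≥ k`. -/
def lift (k : ℕ) : LT → LT
  | var n => if n < k then var n else var (n + 1)
  | app a b => app (lift k a) (lift k b)
  | lam a => lam (lift (k + 1) a)
  | sub a b => sub (lift (k + 1) a) (lift k b)

/-- Lift all free variables by `m`. -/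
def liftN (m : ℕ) (t : LT) : LT := (lift 0)^[m] t

/-- Lift all free variables except the first one by `m`. -/
def liftUnder (m : ℕ) (t : LT) : LT := (lift 1)^[m] t

/-- Capture-avoiding substitution `t{k := u}`. -/
def subst : LT → ℕ → LT → LT
  | var n, k, u => if n < k then var n else if n = k then liftN k u else var (n - 1)
  | app a b, k, u => app (subst a k u) (subst b k u)
  | lam a, k, u => lam (subst a (k + 1) u)
  | sub a b, k, u => sub (subst a (k + 1) u) (subst b k u)

/-- Values: variables and abstractions. -/
def IsValue : LT → Prop
  | var _ => True
  | lam _ => True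
  | _ => False

end LT

/-- Plugging a CBN/CBV term into a list context. -/
def fillLN : LT → List LT → LT
  | s, [] => s
  | s, t :: L => fillLN (LT.sub s t) L

/-- The names of the CBN rewrite rules: `dB` and `s`. -/
inductive NRule : Type
  | dB : NRule
  | s : NRule

/-- Root steps of the CBN rules:
`(dB) L⟨λx.t⟩ u ↦ L⟨t[x←u]⟩` and `(s) t[x←u] ↦ t{x:=u}`. -/
inductive NRoot : NRule → LT → LT → Prop
  | dB (t u : LT) (L : List LT) :
      NRoot NRule.dB (LT.app (fillLN (LT.lam t) L) u)
        (fillLN (LT.sub t (LT.liftN L.length u)) L)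
  | s (t u : LT) : NRoot NRule.s (LT.sub t u) (LT.subst t 0 u)

/-- The names of the CBV rewrite rules: `dB` and `sV`. -/
inductive VRule : Type
  | dB : VRule
  | sV : VRule

/-- Root steps of the CBV rules:
`(dB) L⟨λx.t⟩ u ↦ L⟨t[x←u]⟩` and `(sV) t[x←L⟨v⟩] ↦ L⟨t{x:=v}⟩` for `v` a value. -/
inductive VRoot : VRule → LT → LT → Prop
  | dB (t u : LT) (L : List LT) :
      VRoot VRule.dB (LT.app (fillLN (LT.lam t) L) u)
        (fillLN (LT.sub t (LT.liftN L.length u)) L)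
  | sV (t v : LT) (L : List LT) : v.IsValue →
      VRoot VRule.sV (LT.sub t (fillLN v L))
        (fillLN (LT.subst (LT.liftUnder L.length t) 0 v) L)

/-- (Full) contexts of the CBN/CBV calculi. -/
inductive LCtx : Type
  | hole : LCtx
  | appL : LCtx → LT → LCtx
  | appR : LT → LCtx → LCtx
  | lam : LCtx → LCtx
  | subL : LCtx → LT → LCtx
  | subR : LT → LCtx → LCtx

namespace LCtx

/-- Plugging a term in a CBN/CBV context. -/
def fill : LCtx → LT → LT
  | hole, s => s
  | appL C t, s => LT.app (fill C s) t
  | appR t C, s => LT.app t (fill C s)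
  | lam C, s => LT.lam (fill C s)
  | subL C t, s => LT.sub (fill C s) t
  | subR t C, s => LT.sub t (fill C s)

/-- CBN surface contexts: the hole never occurs in the argument of an application
or of an explicit substitution. -/
def NSurface : LCtx → Prop
  | hole => True
  | appL C _ => NSurface C
  | appR _ _ => False
  | lam C => NSurface C
  | subL C _ => NSurface C
  | subR _ _ => False

/-- CBV surface contexts: the hole never occurs under an abstraction. -/
def VSurface : LCtx → Prop
  | hole => True
  | appL C _ => VSurface C
  | appR _ C => VSurface C
  | lam _ => False
  | subL C _ => VSurface C
  | subR _ C => VSurface C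

end LCtx

/-- `NStepAt R C t u`: the CBN step firing rule `R` under context `C`. -/
def NStepAt (R : NRule) (C : LCtx) (t u : LT) : Prop :=
  ∃ a b, NRoot R a b ∧ t = C.fill a ∧ u = C.fill b

/-- `VStepAt R C t u`: the CBV step firing rule `R` under context `C`. -/
def VStepAt (R : VRule) (C : LCtx) (t u : LT) : Prop :=
  ∃ a b, VRoot R a b ∧ t = C.fill a ∧ u = C.fill b

/-- One CBN step of rule `R` under some full context. -/
def NFStepR (R : NRule) (t u : LT) : Prop := ∃ C : LCtx, NStepAt R C t u

/-- One CBN step of rule `R` under some surface context. -/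
def NSStepR (R : NRule) (t u : LT) : Prop := ∃ C : LCtx, C.NSurface ∧ NStepAt R C t u

/-- One CBN step of rule `R` under some internal context. -/
def NIStepR (R : NRule) (t u : LT) : Prop := ∃ C : LCtx, ¬ C.NSurface ∧ NStepAt R C t u

/-- CBN full reduction `→ⁿF`. -/
def NFStep (t u : LT) : Prop := ∃ R, NFStepR R t u

/-- CBN surface reduction `→ⁿS`. -/
def NSStep (t u : LT) : Prop := ∃ R, NSStepR R t u

/-- CBN internal reduction `→ⁿI`. -/
def NIStep (t u : LT) : Prop := ∃ R, NIStepR R t u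

/-- One CBV step of rule `R` under some full context. -/
def VFStepR (R : VRule) (t u : LT) : Prop := ∃ C : LCtx, VStepAt R C t u

/-- One CBV step of rule `R` under some surface context. -/
def VSStepR (R : VRule) (t u : LT) : Prop := ∃ C : LCtx, C.VSurface ∧ VStepAt R C t u

/-- One CBV step of rule `R` under some internal context. -/
def VIStepR (R : VRule) (t u : LT) : Prop := ∃ C : LCtx, ¬ C.VSurface ∧ VStepAt R C t u

/-- CBV full reduction `→ᵛF`. -/
def VFStep (t u : LT) : Prop := ∃ R, VFStepR R t u

/-- CBV surface reduction `→ᵛS`. -/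
def VSStep (t u : LT) : Prop := ∃ R, VSStepR R t u

/-- CBV internal reduction `→ᵛI`. -/
def VIStep (t u : LT) : Prop := ∃ R, VIStepR R t u

/-! ### The CBN embedding into λ! -/

/-- The CBN embedding `(·)ⁿ : xⁿ = x, (λx.t)ⁿ = λx.tⁿ, (t u)ⁿ = tⁿ !(uⁿ),
(t[x←u])ⁿ = tⁿ[x←!(uⁿ)]`. -/
def embN : LT → T
  | LT.var n => T.var n
  | LT.app t u => T.app (embN t) (T.bang (embN u))
  | LT.lam t => T.lam (embN t)
  | LT.sub t u => T.sub (embN t) (T.bang (embN u))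

/-- The CBN embedding extended to contexts, with `⟨·⟩ⁿ = ⟨·⟩`. -/
def embNC : LCtx → Ctx
  | LCtx.hole => Ctx.hole
  | LCtx.appL C t => Ctx.appL (embNC C) (T.bang (embN t))
  | LCtx.appR t C => Ctx.appR (embN t) (Ctx.bang (embNC C))
  | LCtx.lam C => Ctx.lam (embNC C)
  | LCtx.subL C t => Ctx.subL (embNC C) (T.bang (embN t))
  | LCtx.subR t C => Ctx.subR (embN t) (Ctx.bang (embNC C))

/-- The CBN embedding on rule names: `dBⁿ = dB`, `sⁿ = s!`. -/
def embNRule : NRule → Rule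
  | NRule.dB => Rule.dB
  | NRule.s => Rule.sBang

/-! ### The CBV embedding into λ! -/

/-- If `t = L⟨!s⟩` for a list context `L`, return `some L⟨s⟩`, otherwise `none`. -/
def strip? : T → Option T
  | T.bang s => some s
  | T.sub a b => (strip? a).map (fun a' => T.sub a' b)
  | _ => none

/-- The (new) CBV embedding `(·)ᵛ : xᵛ = !x, (λx.t)ᵛ = !λx.!(tᵛ),
(t u)ᵛ = der(L⟨s⟩ uᵛ)` if `tᵛ = L⟨!s⟩` and `der(der(tᵛ) uᵛ)` otherwise,
`(t[x←u])ᵛ = tᵛ[x←uᵛ]`. -/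
def embV : LT → T
  | LT.var n => T.bang (T.var n)
  | LT.lam t => T.bang (T.lam (T.bang (embV t)))
  | LT.app t u =>
      match strip? (embV t) with
      | some s => T.der (T.app s (embV u))
      | none => T.der (T.app (T.der (embV t)) (embV u))
  | LT.sub t u => T.sub (embV t) (embV u)

/-- The CBV embedding on rule names: `dBᵛ = dB`, `sVᵛ = s!`. -/
def embVRule : VRule → Rule
  | VRule.dB => Rule.dB
  | VRule.sV => Rule.sBang

/-! ### The CBN embedding commutes with the syntactic operations -/

theorem embN_injective : Function.Injective embN := by
  intro t
  induction t with
  | var n => intro u h; cases u <;> simp_all [embN]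
  | app a b iha ihb =>
    intro u h
    cases u <;> simp only [embN, T.app.injEq, T.bang.injEq, reduceCtorEq] at h
    rw [iha h.1, ihb h.2]
  | lam a iha =>
    intro u h
    cases u <;> simp only [embN, T.lam.injEq, reduceCtorEq] at h
    rw [iha h]
  | sub a b iha ihb =>
    intro u h
    cases u <;> simp only [embN, T.sub.injEq, T.bang.injEq, reduceCtorEq] at h
    rw [iha h.1, ihb h.2]

theorem embN_lift (t : LT) (k : ℕ) : embN (t.lift k) = (embN t).lift k := by
  induction t generalizing k with
  | var n => simp only [LT.lift, embN, T.lift]; split <;> rfl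
  | app a b iha ihb => simp [LT.lift, embN, T.lift, iha, ihb]
  | lam a iha => simp [LT.lift, embN, T.lift, iha]
  | sub a b iha ihb => simp [LT.lift, embN, T.lift, iha, ihb]

theorem embN_liftN (m : ℕ) (t : LT) : embN (t.liftN m) = (embN t).liftN m :=
  (Function.Semiconj.iterate_right (fun t => embN_lift t 0) m) t

theorem liftN_bang (m : ℕ) (t : T) : (T.bang t).liftN m = T.bang (t.liftN m) :=
  ((Function.Semiconj.iterate_right (f := T.bang) (ga := T.lift 0) (gb := T.lift 0)
    (fun _ => rfl) m) t).symm

theorem embN_subst (t u : LT) (k : ℕ) :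
    embN (t.subst k u) = (embN t).subst k (embN u) := by
  induction t generalizing k with
  | var n =>
    simp only [LT.subst, embN, T.subst]
    split_ifs <;> simp [embN, embN_liftN]
  | app a b iha ihb => simp [LT.subst, embN, T.subst, iha, ihb]
  | lam a iha => simp [LT.subst, embN, T.subst, iha]
  | sub a b iha ihb => simp [LT.subst, embN, T.subst, iha, ihb]

theorem embN_fillLN (s : LT) (L : List LT) :
    embN (fillLN s L) = fillL (embN s) (L.map fun t => T.bang (embN t)) := by
  induction L generalizing s with
  | nil => rfl
  | cons t L ih => simp [fillLN, fillL, ih, embN]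

theorem embN_fill (C : LCtx) (s : LT) : embN (C.fill s) = (embNC C).fill (embN s) := by
  induction C <;> simp_all [LCtx.fill, embNC, Ctx.fill, embN]

theorem surface_embNC {C : LCtx} (h : C.NSurface) : (embNC C).Surface := by
  induction C <;> simp_all [LCtx.NSurface, embNC, Ctx.Surface]

/-- Whenever an embedded term is of the form `L⟨s⟩`, so is the original term. -/
theorem exists_fillLN_of_embN_eq_fillL {t : LT} {s : T} {L : List T}
    (h : embN t = fillL s L) :
    ∃ (s₀ : LT) (L₀ : List LT), t = fillLN s₀ L₀ ∧ embN s₀ = s ∧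
      (L₀.map fun t => T.bang (embN t)) = L := by
  induction L generalizing s with
  | nil => exact ⟨t, [], rfl, h, rfl⟩
  | cons a L ih =>
    obtain ⟨s₀, L₀, rfl, hs, rfl⟩ := ih h
    cases s₀ <;> simp only [embN, T.sub.injEq, reduceCtorEq] at hs
    rename_i s₁ a₁
    exact ⟨s₁, a₁ :: L₀, rfl, hs.1, by simp [hs.2]⟩

theorem fillL_bang_eq_bang {u v : T} {L : List T} (h : T.bang v = fillL (T.bang u) L) :
    L = [] ∧ u = v := by
  have key : ∀ (L : List T) (s : T), T.bang v = fillL s L → L = [] := by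
    intro L
    induction L with
    | nil => intros; rfl
    | cons a L ih =>
      intro s h
      obtain rfl := ih _ h
      simp [fillL] at h
  obtain rfl := key L _ h
  simp only [fillL, T.bang.injEq] at h
  exact ⟨rfl, h.symm⟩

/-! ### One-step simulation -/

theorem NRoot.map_embN {R : NRule} {a b : LT} (h : NRoot R a b) :
    Root (embNRule R) (embN a) (embN b) := by
  cases h with
  | dB t u L =>
    have := Root.dB (embN t) (T.bang (embN u))
      (L.map fun t => T.bang (embN t))
    simpa [embN, embN_fillLN, embN_liftN, liftN_bang, embNRule] using this
  | s t u =>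
    have := Root.sBang (embN t) (embN u) []
    simpa [fillL, T.liftUnder, embN, embN_subst, embNRule] using this

theorem NSStepR.map_embN {R : NRule} {t u : LT} (h : NSStepR R t u) :
    SStepR (embNRule R) (embN t) (embN u) := by
  obtain ⟨C, hC, a, b, hab, rfl, rfl⟩ := h
  exact ⟨embNC C, surface_embNC hC, _, _, hab.map_embN, embN_fill C a, embN_fill C b⟩

theorem NRoot.of_embN {R : Rule} {t : LT} {b : T} (h : Root R (embN t) b) :
    ∃ (R₀ : NRule) (u : LT), embNRule R₀ = R ∧ NRoot R₀ t u ∧ embN u = b := by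
  generalize ha : embN t = a at h
  cases h with
  | dB s v L =>
    cases t <;> simp only [embN, T.app.injEq, reduceCtorEq] at ha
    rename_i t₁ v₁
    obtain ⟨ht, rfl⟩ := ha
    obtain ⟨s₀, L₀, rfl, hs, rfl⟩ := exists_fillLN_of_embN_eq_fillL ht
    cases s₀ <;> simp only [embN, T.lam.injEq, reduceCtorEq] at hs
    subst hs
    exact ⟨_, _, rfl, NRoot.dB _ _ _,
      by simp [embN_fillLN, embN, embN_liftN, liftN_bang]⟩
  | sBang s v L =>
    cases t <;> simp only [embN, T.sub.injEq, reduceCtorEq] at ha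
    obtain ⟨rfl, hv⟩ := ha
    obtain ⟨rfl, rfl⟩ := fillL_bang_eq_bang hv
    exact ⟨_, _, rfl, NRoot.s _ _, by simp [embN_subst, fillL, T.liftUnder]⟩
  | dBang s L =>
    cases t <;> simp [embN] at ha

theorem not_sStepR_bang {R : Rule} {s v : T} : ¬ SStepR R (T.bang s) v := by
  rintro ⟨C, hC, a, b, hab, h, -⟩
  cases C <;> simp only [Ctx.fill, reduceCtorEq] at h
  · subst h; cases hab
  · exact hC

theorem NSStepR.lam {R : NRule} {t u : LT} (h : NSStepR R t u) :
    NSStepR R (LT.lam t) (LT.lam u) := by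
  obtain ⟨C, hC, a, b, hab, rfl, rfl⟩ := h
  exact ⟨LCtx.lam C, hC, a, b, hab, rfl, rfl⟩

theorem NSStepR.app {R : NRule} {t u : LT} (h : NSStepR R t u) (v : LT) :
    NSStepR R (LT.app t v) (LT.app u v) := by
  obtain ⟨C, hC, a, b, hab, rfl, rfl⟩ := h
  exact ⟨LCtx.appL C v, hC, a, b, hab, rfl, rfl⟩

theorem NSStepR.sub {R : NRule} {t u : LT} (h : NSStepR R t u) (v : LT) :
    NSStepR R (LT.sub t v) (LT.sub u v) := by
  obtain ⟨C, hC, a, b, hab, rfl, rfl⟩ := h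
  exact ⟨LCtx.subL C v, hC, a, b, hab, rfl, rfl⟩

/-- Every surface step from an embedded term is the image of a CBN surface step. -/
theorem NSStepR.of_embN {R : Rule} {t : LT} {s' : T} (h : SStepR R (embN t) s') :
    ∃ (R₀ : NRule) (u : LT), embNRule R₀ = R ∧ NSStepR R₀ t u ∧ embN u = s' := by
  obtain ⟨C, hC, a, b, hab, ht, rfl⟩ := h
  induction C generalizing t with
  | hole =>
    simp only [Ctx.fill] at ht
    subst ht
    obtain ⟨R₀, u, hR, hu, rfl⟩ := NRoot.of_embN hab
    exact ⟨R₀, u, hR, ⟨LCtx.hole, trivial, t, u, hu, rfl, rfl⟩, rfl⟩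
  | appL C v ih =>
    cases t <;> simp only [embN, Ctx.fill, T.app.injEq, reduceCtorEq] at ht
    obtain ⟨ht, rfl⟩ := ht
    obtain ⟨R₀, u, hR, hu, hub⟩ := ih hC ht
    exact ⟨R₀, _, hR, hu.app _, by simp [embN, Ctx.fill, hub]⟩
  | appR v C ih =>
    cases t <;> simp only [embN, Ctx.fill, T.app.injEq, reduceCtorEq] at ht
    exact (not_sStepR_bang ⟨C, hC, a, b, hab, ht.2, rfl⟩).elim
  | lam C ih =>
    cases t <;> simp only [embN, Ctx.fill, T.lam.injEq, reduceCtorEq] at ht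
    obtain ⟨R₀, u, hR, hu, hub⟩ := ih hC ht
    exact ⟨R₀, _, hR, hu.lam, by simp [embN, Ctx.fill, hub]⟩
  | bang C ih => exact hC.elim
  | der C ih => cases t <;> simp [embN, Ctx.fill] at ht
  | subL C v ih =>
    cases t <;> simp only [embN, Ctx.fill, T.sub.injEq, reduceCtorEq] at ht
    obtain ⟨ht, rfl⟩ := ht
    obtain ⟨R₀, u, hR, hu, hub⟩ := ih hC ht
    exact ⟨R₀, _, hR, hu.sub _, by simp [embN, Ctx.fill, hub]⟩
  | subR v C ih =>
    cases t <;> simp only [embN, Ctx.fill, T.sub.injEq, reduceCtorEq] at ht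
    exact (not_sStepR_bang ⟨C, hC, a, b, hab, ht.2, rfl⟩).elim

theorem NSStep.map_embN {t u : LT} (h : NSStep t u) : SStep (embN t) (embN u) :=
  let ⟨_, h⟩ := h
  ⟨_, h.map_embN⟩

theorem NSStep.of_embN {t : LT} {s' : T} (h : SStep (embN t) s') :
    ∃ u : LT, NSStep t u ∧ embN u = s' := by
  obtain ⟨R, h⟩ := h
  obtain ⟨R₀, u, -, hu, rfl⟩ := NSStepR.of_embN h
  exact ⟨u, ⟨R₀, hu⟩, rfl⟩

/-! ### Simulation of reduction sequences -/

theorem reflTransGen_nsStep_of_embN {t : LT} {s' : T}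
    (h : Relation.ReflTransGen SStep (embN t) s') :
    ∃ u : LT, Relation.ReflTransGen NSStep t u ∧ embN u = s' := by
  induction h with
  | refl => exact ⟨t, .refl, rfl⟩
  | tail _ hstep ih =>
    obtain ⟨u, hu, rfl⟩ := ih
    obtain ⟨v, hv, rfl⟩ := NSStep.of_embN hstep
    exact ⟨v, hu.tail hv, rfl⟩

theorem Counted2.map_embN {m n : ℕ} {t u : LT}
    (h : Counted2 (NSStepR NRule.dB) (NSStepR NRule.s) m n t u) :
    Counted3 (SStepR Rule.dB) (SStepR Rule.sBang) (SStepR Rule.dBang)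
      m n 0 (embN t) (embN u) := by
  induction h with
  | refl t => exact .refl _
  | step₁ h _ ih => exact .step₁ h.map_embN ih
  | step₂ h _ ih => exact .step₂ h.map_embN ih

theorem Counted2.of_embN {m n k : ℕ} {t u : LT}
    (h : Counted3 (SStepR Rule.dB) (SStepR Rule.sBang) (SStepR Rule.dBang)
      m n k (embN t) (embN u)) :
    Counted2 (NSStepR NRule.dB) (NSStepR NRule.s) m n t u := by
  generalize hs : embN t = s at h
  generalize hv : embN u = v at h
  induction h generalizing t with
  | refl =>
    obtain rfl := embN_injective (hs.trans hv.symm)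
    exact .refl _
  | step₁ h _ ih =>
    subst hs
    obtain ⟨R₀, w, hR, hw, hwv⟩ := NSStepR.of_embN h
    cases R₀ <;> simp only [embNRule, reduceCtorEq] at hR
    exact .step₁ hw (ih hwv hv)
  | step₂ h _ ih =>
    subst hs
    obtain ⟨R₀, w, hR, hw, hwv⟩ := NSStepR.of_embN h
    cases R₀ <;> simp only [embNRule, reduceCtorEq] at hR
    exact .step₂ hw (ih hwv hv)
  | step₃ h _ ih =>
    subst hs
    obtain ⟨R₀, w, hR, hw, hwv⟩ := NSStepR.of_embN h
    cases R₀ <;> simp only [embNRule, reduceCtorEq] at hR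

/-- **CBN surface preservation.**
(1) Stability: if `tⁿ →S* s'` then `s' = sⁿ` for some CBN term `s`.
(2) Normal forms: `t` is a `→ⁿS`-normal form iff `tⁿ` is a `→S`-normal form.
(3) Simulations: `t →ⁿS* u` iff `tⁿ →S* uⁿ`; moreover corresponding sequences have the
same number of `dB`-steps, and the number of `s`-steps on the CBN side equals the number
of `s!`-steps on the λ! side (no `d!`-steps appear on the λ! side). -/
theorem cbn_surface_preservation (t u : LT) (s' : T) :
    (Relation.ReflTransGen SStep (embN t) s' → ∃ s : LT, embN s = s') ∧
    (IsNF NSStep t ↔ IsNF SStep (embN t)) ∧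
    (Relation.ReflTransGen NSStep t u ↔
      Relation.ReflTransGen SStep (embN t) (embN u)) ∧
    (∀ m n : ℕ, Counted2 (NSStepR NRule.dB) (NSStepR NRule.s) m n t u →
      Counted3 (SStepR Rule.dB) (SStepR Rule.sBang) (SStepR Rule.dBang)
        m n 0 (embN t) (embN u)) ∧
    (∀ m n k : ℕ,
      Counted3 (SStepR Rule.dB) (SStepR Rule.sBang) (SStepR Rule.dBang)
        m n k (embN t) (embN u) →
      Counted2 (NSStepR NRule.dB) (NSStepR NRule.s) m n t u) := by
  refine ⟨fun h => ?_, ⟨fun h s hs => ?_, fun h s hs => h _ hs.map_embN⟩, ⟨fun h => ?_, fun h => ?_⟩,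
    fun _ _ h => h.map_embN, fun _ _ _ h => Counted2.of_embN h⟩
  · obtain ⟨s, -, hs⟩ := reflTransGen_nsStep_of_embN h
    exact ⟨s, hs⟩
  · obtain ⟨v, hv, -⟩ := NSStep.of_embN hs
    exact h v hv
  · exact h.lift embN fun _ _ hab => hab.map_embN
  · obtain ⟨v, hv, hvu⟩ := reflTransGen_nsStep_of_embN h
    rwa [← embN_injective hvu]

end BangPaper
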